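/- Let κ be a regular cardinal with κ ≥ ℵ₁ and X a T1 topological space with odL(X) ≤ κ, and let D ⊆ X be the set of isolated points of X. Then X can be partitioned as X = D ⊔ X₀ ⊔ X₁, where X₀ ∪ D is open in X, L(closure of X₀) ≤ κ, X₁ is closed in X with ℓL(X₁) ≤ κ, and every open set U ⊆ X meeting X₁ satisfies L(U) > κ (subspace topologies). -/

import Mathlib

universe u

open Cardinal

/-- `OdLle X κ`: every cover of `X` by dense open sets has a subcover of
cardinality `< κ`. -/
def OdLle (X : Type u) [TopologicalSpace X] (κ : Cardinal.{u}) : Prop :=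
  ∀ S : Set (Set X), (∀ U ∈ S, IsOpen U ∧ Dense U) → ⋃₀ S = Set.univ →
    ∃ T ⊆ S, #T < κ ∧ ⋃₀ T = Set.univ

/-- `Lle X κ`: every open cover of `X` has a subcover of cardinality `< κ`. -/
def Lle (X : Type u) [TopologicalSpace X] (κ : Cardinal.{u}) : Prop :=
  ∀ S : Set (Set X), (∀ U ∈ S, IsOpen U) → ⋃₀ S = Set.univ →
    ∃ T ⊆ S, #T < κ ∧ ⋃₀ T = Set.univ

/-- `LinLle X κ`: every open cover of `X` that is a chain under inclusion has a
subcover of cardinality `< κ`. -/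
def LinLle (X : Type u) [TopologicalSpace X] (κ : Cardinal.{u}) : Prop :=
  ∀ S : Set (Set X), (∀ U ∈ S, IsOpen U) → IsChain (· ⊆ ·) S → ⋃₀ S = Set.univ →
    ∃ T ⊆ S, #T < κ ∧ ⋃₀ T = Set.univ

/-- `OdCompact X`: every cover of `X` by dense open sets has a finite subcover. -/
def OdCompact (X : Type u) [TopologicalSpace X] : Prop :=
  ∀ S : Set (Set X), (∀ U ∈ S, IsOpen U ∧ Dense U) → ⋃₀ S = Set.univ →
    ∃ T ⊆ S, T.Finite ∧ ⋃₀ T = Set.univ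

open Set

/-- `IsSmall κ A`: every family of open sets of the ambient space covering `A` has a subfamily
of cardinality `< κ` covering `A`. -/
def IsSmall {X : Type u} [TopologicalSpace X] (κ : Cardinal.{u}) (A : Set X) : Prop :=
  ∀ S : Set (Set X), (∀ U ∈ S, IsOpen U) → A ⊆ ⋃₀ S → ∃ T ⊆ S, #T < κ ∧ A ⊆ ⋃₀ T

theorem exists_subset_image_eq_mk_le {α β : Type u} {f : α → β} {S : Set α} {T : Set β}
    (h : T ⊆ f '' S) : ∃ R ⊆ S, f '' R = T ∧ #R ≤ #T := by
  choose g hgS hg using fun t : T => h t.2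
  refine ⟨range g, range_subset_iff.2 hgS, ?_, mk_range_le⟩
  rw [← range_comp, show f ∘ g = Subtype.val from funext hg, Subtype.range_coe]

theorem exists_maximal_pairwise {α : Type*} (p : α → Prop) (r : α → α → Prop)
    (hr : ∀ a b, r a b → r b a) :
    ∃ s : Set α, (∀ a ∈ s, p a) ∧ s.Pairwise r ∧
      ∀ a, p a → (∀ b ∈ s, r a b) → a ∈ s := by
  obtain ⟨m, hm⟩ : ∃ m : Set {a // p a}, IsMaxChain (fun a b => r a.1 b.1) m :=
    ⟨_, maxChain_spec⟩
  refine ⟨Subtype.val '' m, ?_, ?_, ?_⟩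
  · rintro _ ⟨a, -, rfl⟩
    exact a.2
  · rintro _ ⟨a, ha, rfl⟩ _ ⟨b, hb, rfl⟩ hab
    rcases hm.1 ha hb (fun h => hab (congrArg _ h)) with h | h
    · exact h
    · exact hr _ _ h
  · intro a ha hab
    refine ⟨⟨a, ha⟩, ?_, rfl⟩
    have hins := hm.2 (hm.1.insert (a := ⟨a, ha⟩)
      (fun b hb _ => Or.inl (hab _ ⟨b, hb, rfl⟩))) (subset_insert _ _)
    rw [hins]
    exact mem_insert _ _

section

variable {X : Type u} [TopologicalSpace X] {κ : Cardinal.{u}}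

theorem isSmall_iff_Lle {A : Set X} : IsSmall κ A ↔ Lle A κ := by
  constructor
  · intro h S hS hcov
    obtain ⟨T, hTS, hT, hAT⟩ := h {U | IsOpen U ∧ Subtype.val ⁻¹' U ∈ S} (fun U hU => hU.1) (by
      intro x hx
      obtain ⟨V, hV, hxV⟩ : (⟨x, hx⟩ : A) ∈ ⋃₀ S := hcov ▸ mem_univ _
      obtain ⟨U, hU, rfl⟩ := isOpen_induced_iff.1 (hS V hV)
      exact ⟨U, ⟨hU, hV⟩, hxV⟩)
    refine ⟨preimage Subtype.val '' T, ?_, mk_image_le.trans_lt hT, ?_⟩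
    · rintro _ ⟨U, hU, rfl⟩
      exact (hTS hU).2
    · refine eq_univ_of_forall fun x => ?_
      obtain ⟨U, hU, hxU⟩ := hAT x.2
      exact ⟨_, ⟨U, hU, rfl⟩, hxU⟩
  · intro h S hS hcov
    obtain ⟨T, hTS, hT, hAT⟩ := h (preimage Subtype.val '' S)
      (by
        rintro _ ⟨U, hU, rfl⟩
        exact (hS U hU).preimage continuous_subtype_val)
      (by
        refine eq_univ_of_forall fun x => ?_
        obtain ⟨U, hU, hxU⟩ := hcov x.2
        exact ⟨_, ⟨U, hU, rfl⟩, hxU⟩)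
    obtain ⟨R, hRS, rfl, hR⟩ := exists_subset_image_eq_mk_le hTS
    refine ⟨R, hRS, hR.trans_lt hT, fun x hx => ?_⟩
    obtain ⟨_, ⟨U, hU, rfl⟩, hxU⟩ : (⟨x, hx⟩ : A) ∈ ⋃₀ (preimage Subtype.val '' R) :=
      hAT ▸ mem_univ _
    exact ⟨U, hU, hxU⟩

theorem isSmall_singleton (hκ : ℵ₀ ≤ κ) (x : X) : IsSmall κ ({x} : Set X) := by
  intro S _ hcov
  obtain ⟨U, hU, hxU⟩ := hcov rfl
  exact ⟨{U}, singleton_subset_iff.2 hU, (lt_aleph0_of_finite _).trans_le hκ, by simpa using hxU⟩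

theorem IsSmall.of_isClosed_subset {A F : Set X} (hA : IsSmall κ A)
    (hF : IsClosed F) (hFA : F ⊆ A) : IsSmall κ F := by
  intro S hS hcov
  obtain ⟨T, hTS, hT, hAT⟩ := hA (insert Fᶜ S)
    (by
      rintro U (rfl | hU)
      · exact hF.isOpen_compl
      · exact hS U hU)
    (by
      intro x _
      by_cases hx : x ∈ F
      · obtain ⟨U, hU, hxU⟩ := hcov hx
        exact ⟨U, Or.inr hU, hxU⟩
      · exact ⟨Fᶜ, Or.inl rfl, hx⟩)
  refine ⟨T ∩ S, inter_subset_right, (mk_le_mk_of_subset inter_subset_left).trans_lt hT, ?_⟩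
  intro x hx
  obtain ⟨U, hU, hxU⟩ := hAT (hFA hx)
  rcases hTS hU with rfl | h
  · exact absurd hx hxU
  · exact ⟨U, ⟨hU, h⟩, hxU⟩

theorem IsSmall.union (hκ : ℵ₀ ≤ κ) {A B : Set X} (hA : IsSmall κ A) (hB : IsSmall κ B) :
    IsSmall κ (A ∪ B) := by
  intro S hS hcov
  obtain ⟨T, hTS, hT, hAT⟩ := hA S hS (subset_union_left.trans hcov)
  obtain ⟨R, hRS, hR, hBR⟩ := hB S hS (subset_union_right.trans hcov)
  refine ⟨T ∪ R, union_subset hTS hRS, (mk_union_le _ _).trans_lt (add_lt_of_lt hκ hT hR), ?_⟩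
  rw [sUnion_union]
  exact union_subset_union hAT hBR

theorem IsSmall.biUnion (hκ : κ.IsRegular) {ι : Type u} {I : Set ι} (hI : #I < κ)
    {A : ι → Set X} (hA : ∀ i ∈ I, IsSmall κ (A i)) : IsSmall κ (⋃ i ∈ I, A i) := by
  intro S hS hcov
  have hT : ∀ i ∈ I, ∃ T ⊆ S, #T < κ ∧ A i ⊆ ⋃₀ T := fun i hi =>
    hA i hi S hS ((subset_biUnion_of_mem hi).trans hcov)
  choose! T hTS hTκ hAT using hT
  refine ⟨⋃ i ∈ I, T i, iUnion₂_subset hTS,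
    (card_biUnion_lt_iff_forall_of_isRegular hκ hI).2 hTκ, ?_⟩
  refine iUnion₂_subset fun i hi x hx => ?_
  obtain ⟨U, hU, hxU⟩ := hAT i hi hx
  exact ⟨U, mem_biUnion hi hU, hxU⟩

theorem OdLle.isSmall_of_interior_eq_empty (hod : OdLle X κ) (hκ : ℵ₀ ≤ κ) {N : Set X}
    (hN : IsClosed N) (hint : interior N = ∅) : IsSmall κ N := by
  intro S hS hcov
  rcases S.eq_empty_or_nonempty with rfl | ⟨U₀, hU₀⟩
  · exact ⟨∅, subset_rfl, (lt_aleph0_of_finite _).trans_le hκ, hcov⟩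
  obtain ⟨T, hTS, hT, hcovT⟩ := hod ((fun U => U ∪ Nᶜ) '' S)
    (by
      rintro _ ⟨U, hU, rfl⟩
      exact ⟨(hS U hU).union hN.isOpen_compl,
        (interior_eq_empty_iff_dense_compl.1 hint).mono subset_union_right⟩)
    (by
      refine eq_univ_of_forall fun x => ?_
      by_cases hx : x ∈ N
      · obtain ⟨U, hU, hxU⟩ := hcov hx
        exact ⟨_, ⟨U, hU, rfl⟩, Or.inl hxU⟩
      · exact ⟨_, ⟨U₀, hU₀, rfl⟩, Or.inr hx⟩)
  obtain ⟨R, hRS, rfl, hR⟩ := exists_subset_image_eq_mk_le hTS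
  refine ⟨R, hRS, hR.trans_lt hT, fun x hx => ?_⟩
  obtain ⟨_, ⟨U, hU, rfl⟩, hxU⟩ : x ∈ ⋃₀ ((fun U => U ∪ Nᶜ) '' R) := hcovT ▸ mem_univ x
  exact ⟨U, hU, hxU.resolve_right fun h => h hx⟩

theorem interior_closure_image_eq_empty_of_pairwiseDisjoint [T1Space X] {ι : Type*} {s : Set ι}
    {A : ι → Set X} {x : ι → X} (hA : ∀ i ∈ s, IsOpen (A i)) (hd : s.PairwiseDisjoint A)
    (hx : ∀ i ∈ s, x i ∈ A i) (hiso : ∀ i ∈ s, ¬ IsOpen ({x i} : Set X)) :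
    interior (closure (x '' s)) = ∅ := by
  by_contra hne
  obtain ⟨y, hy⟩ := nonempty_iff_ne_empty.2 hne
  obtain ⟨_, hiV, i, hi, rfl⟩ := mem_closure_iff.1 (interior_subset hy) _ isOpen_interior hy
  refine hiso i hi ?_
  have heq : interior (closure (x '' s)) ∩ A i = {x i} := by
    refine Subset.antisymm ?_ (singleton_subset_iff.2 ⟨hiV, hx i hi⟩)
    rintro z ⟨hzV, hzA⟩
    by_contra hz
    obtain ⟨_, ⟨hjA, hji⟩, j, hj, rfl⟩ := mem_closure_iff.1 (interior_subset hzV)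
      (A i \ {x i}) ((hA i hi).sdiff isClosed_singleton) ⟨hzA, hz⟩
    have hij : i ≠ j := by
      rintro rfl
      exact hji rfl
    exact disjoint_left.1 (hd hi hj hij) hjA (hx j hj)
  rw [← heq]
  exact isOpen_interior.inter (hA i hi)

/-- An open set without isolated points that is covered by small open sets has small closure. -/
theorem OdLle.isSmall_closure [T1Space X] (hod : OdLle X κ) (hκ : κ.IsRegular) {G : Set X}
    (hG : IsOpen G) (hiso : ∀ x ∈ G, ¬ IsOpen ({x} : Set X))
    (hloc : ∀ x ∈ G, ∃ U, IsOpen U ∧ x ∈ U ∧ IsSmall κ U) : IsSmall κ (closure G) := by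
  obtain ⟨𝒜, h𝒜, hdisj, hmax⟩ := exists_maximal_pairwise
    (fun A : Set X => IsOpen A ∧ A ⊆ G ∧ ∃ U, A ⊆ U ∧ IsSmall κ U) Disjoint
    (fun _ _ h => h.symm)
  have hN : IsSmall κ (closure G \ ⋃₀ 𝒜) := by
    refine hod.isSmall_of_interior_eq_empty hκ.aleph0_le
      (isClosed_closure.sdiff (isOpen_sUnion fun A hA => (h𝒜 A hA).1)) ?_
    by_contra hne
    obtain ⟨y, hy⟩ := nonempty_iff_ne_empty.2 hne
    obtain ⟨p, hpV, hpG⟩ := mem_closure_iff.1 (interior_subset hy).1 _ isOpen_interior hy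
    obtain ⟨U, hU, hpU, hUs⟩ := hloc p hpG
    refine (interior_subset hpV).2 ⟨interior (closure G \ ⋃₀ 𝒜) ∩ G ∩ U, ?_, ⟨hpV, hpG⟩, hpU⟩
    refine hmax _ ⟨(isOpen_interior.inter hG).inter hU, fun z hz => hz.1.2, U,
      inter_subset_right, hUs⟩ fun B hB => ?_
    exact disjoint_left.2 fun z hz hzB => (interior_subset hz.1.1).2 ⟨B, hB, hzB⟩
  intro S hS hcov
  rcases isEmpty_or_nonempty X with hX | hX
  · exact ⟨∅, empty_subset _, (lt_aleph0_of_finite _).trans_le hκ.aleph0_le, fun x => hX.elim x⟩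
  obtain ⟨T, hTS, hT, hNT⟩ := hN S hS (sdiff_subset.trans hcov)
  have hF : IsClosed (closure G \ ⋃₀ T) :=
    isClosed_closure.sdiff (isOpen_sUnion fun U hU => hS U (hTS hU))
  have hF𝒜 : closure G \ ⋃₀ T ⊆ ⋃₀ 𝒜 := fun z hz => by
    by_contra h
    exact hz.2 (hNT ⟨hz.1, h⟩)
  set F := closure G \ ⋃₀ T
  have hpt : ∀ A ∈ {A ∈ 𝒜 | (A ∩ F).Nonempty}, ∃ x, x ∈ A ∧ x ∈ F := fun A hA => hA.2
  choose! x hxA hxF using hpt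
  have hE : IsSmall κ (closure (x '' {A ∈ 𝒜 | (A ∩ F).Nonempty})) := by
    refine hod.isSmall_of_interior_eq_empty hκ.aleph0_le isClosed_closure ?_
    exact interior_closure_image_eq_empty_of_pairwiseDisjoint (A := id)
      (fun A hA => (h𝒜 A hA.1).1) (fun A hA B hB hAB => hdisj hA.1 hB.1 hAB) hxA
      (fun A hA => hiso _ ((h𝒜 A hA.1).2.1 (hxA A hA)))
  obtain ⟨R, hR𝒜, hR, hER⟩ := hE 𝒜 (fun A hA => (h𝒜 A hA).1)
    ((closure_minimal (by
      rintro _ ⟨A, hA, rfl⟩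
      exact hxF A hA) hF).trans hF𝒜)
  have hsub : {A ∈ 𝒜 | (A ∩ F).Nonempty} ⊆ R := by
    intro A hA
    obtain ⟨B, hB, hxB⟩ := hER (subset_closure ⟨A, hA, rfl⟩)
    have hAB : A = B := by
      by_contra hne
      exact disjoint_left.1 (hdisj hA.1 (hR𝒜 hB) hne) (hxA A hA) hxB
    exact hAB ▸ hB
  have hFs : IsSmall κ (⋃ A ∈ {A ∈ 𝒜 | (A ∩ F).Nonempty}, A ∩ F) := by
    refine IsSmall.biUnion hκ ((mk_le_mk_of_subset hsub).trans_lt hR) fun A hA => ?_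
    obtain ⟨-, -, U, hAU, hU⟩ := h𝒜 A hA.1
    refine hU.of_isClosed_subset ?_ (inter_subset_left.trans hAU)
    have heq : A ∩ F = F \ ⋃₀ (𝒜 \ {A}) := by
      ext z
      constructor
      · rintro ⟨hzA, hzF⟩
        refine ⟨hzF, ?_⟩
        rintro ⟨B, ⟨hB, hBA⟩, hzB⟩
        exact disjoint_left.1 (hdisj hB hA.1 hBA) hzB hzA
      · rintro ⟨hzF, hz⟩
        obtain ⟨B, hB, hzB⟩ := hF𝒜 hzF
        by_cases hBA : B = A
        · exact ⟨hBA ▸ hzB, hzF⟩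
        · exact absurd ⟨B, ⟨hB, hBA⟩, hzB⟩ hz
    rw [heq]
    exact hF.sdiff (isOpen_sUnion fun B hB => (h𝒜 B hB.1).1)
  obtain ⟨Q, hQS, hQ, hFQ⟩ := hFs S hS
    (iUnion₂_subset fun A _ z hz => hcov hz.2.1)
  refine ⟨T ∪ Q, union_subset hTS hQS,
    (mk_union_le _ _).trans_lt (add_lt_of_lt hκ.aleph0_le hT hQ), fun z hz => ?_⟩
  rw [sUnion_union]
  by_cases hzT : z ∈ ⋃₀ T
  · exact Or.inl hzT
  · obtain ⟨A, hA, hzA⟩ := hF𝒜 ⟨hz, hzT⟩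
    exact Or.inr (hFQ (mem_biUnion (x := A) ⟨hA, z, hzA, hz, hzT⟩ ⟨hzA, hz, hzT⟩))

/-- Chains of open sets covering a closed set without points isolated in `X` have subcovers of
cardinality `< κ`. -/
theorem OdLle.exists_subcover_of_isChain [T1Space X] (hod : OdLle X κ) (hκ : ℵ₀ ≤ κ) {C : Set X}
    (hC : IsClosed C) (hiso : ∀ x ∈ C, ¬ IsOpen ({x} : Set X)) {S : Set (Set X)}
    (hS : ∀ U ∈ S, IsOpen U) (hchain : IsChain (· ⊆ ·) S) (hcov : C ⊆ ⋃₀ S) :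
    ∃ T ⊆ S, #T < κ ∧ C ⊆ ⋃₀ T := by
  by_contra hno
  have hbdd : ∀ Z ⊆ C, IsClosed Z → interior Z = ∅ → ∃ U ∈ S, Z ⊆ U := by
    intro Z hZC hZ hint
    obtain ⟨T, hTS, hT, hZT⟩ :=
      hod.isSmall_of_interior_eq_empty hκ hZ hint S hS (hZC.trans hcov)
    have hCT : ¬ C ⊆ ⋃₀ T := fun h => hno ⟨T, hTS, hT, h⟩
    obtain ⟨y, hyC, hyT⟩ := not_subset.1 hCT
    obtain ⟨U, hU, hyU⟩ := hcov hyC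
    refine ⟨U, hU, fun z hz => ?_⟩
    obtain ⟨V, hV, hzV⟩ := hZT hz
    rcases hchain.total (hTS hV) hU with h | h
    · exact h hzV
    · exact absurd ⟨V, hV, h hyU⟩ hyT
  have hstep : ∀ W ∈ S, ∃ V ∈ S, (interior (C \ W) ∩ V).Nonempty := by
    intro W hW
    have hne : (interior (C \ W)).Nonempty := by
      by_contra hemp
      obtain ⟨U, hU, hCU⟩ := hbdd (C \ W) sdiff_subset (hC.sdiff (hS W hW))
        (not_nonempty_iff_eq_empty.1 hemp)
      refine hno ⟨{W, U}, insert_subset hW (singleton_subset_iff.2 hU),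
        (lt_aleph0_of_finite _).trans_le hκ, fun z hz => ?_⟩
      by_cases hzW : z ∈ W
      · exact ⟨W, Or.inl rfl, hzW⟩
      · exact ⟨U, Or.inr rfl, hCU ⟨hz, hzW⟩⟩
    obtain ⟨y, hy⟩ := hne
    obtain ⟨V, hV, hyV⟩ := hcov (interior_subset hy).1
    exact ⟨V, hV, y, hy, hyV⟩
  obtain ⟨P, hP, hpair, hmax⟩ := exists_maximal_pairwise
    (fun p : Set X × Set X => p.1 ∈ S ∧ p.2 ∈ S ∧ (interior (C \ p.1) ∩ p.2).Nonempty)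
    (fun p q => p.2 ⊆ q.1 ∨ q.2 ⊆ p.1) (fun _ _ h => h.symm)
  have hunb : ∀ W ∈ S, ∃ p ∈ P, ¬ p.2 ⊆ W := by
    intro W hW
    by_contra! hall
    obtain ⟨V, hV, y, hy, hyV⟩ := hstep W hW
    have hmem : (W, V) ∈ P := hmax (W, V) ⟨hW, hV, y, hy, hyV⟩ fun q hq => Or.inr (hall q hq)
    exact (interior_subset hy).2 (hall _ hmem hyV)
  obtain ⟨W₀, hW₀, -⟩ := hbdd ∅ (empty_subset _) isClosed_empty interior_empty
  obtain ⟨-, -, x₀, -⟩ := hstep W₀ hW₀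
  have : Nonempty X := ⟨x₀⟩
  have hpt : ∀ p ∈ P, ∃ x, x ∈ interior (C \ p.1) ∩ p.2 := fun p hp => (hP p hp).2.2
  choose! x hx using hpt
  have hdisj : P.PairwiseDisjoint fun p => interior (C \ p.1) ∩ p.2 := by
    intro p hp q hq hpq
    refine disjoint_left.2 fun z hzp hzq => ?_
    rcases hpair hp hq hpq with h | h
    · exact (interior_subset hzq.1).2 (h hzp.2)
    · exact (interior_subset hzp.1).2 (h hzq.2)
  have hxC : ∀ p ∈ P, x p ∈ C \ p.1 := fun p hp => interior_subset (hx p hp).1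
  obtain ⟨W, hW, hEW⟩ := hbdd (closure (x '' P))
    (closure_minimal (by
      rintro _ ⟨p, hp, rfl⟩
      exact (hxC p hp).1) hC)
    isClosed_closure
    (interior_closure_image_eq_empty_of_pairwiseDisjoint
      (fun p hp => isOpen_interior.inter (hS _ (hP p hp).2.1)) hdisj hx
      (fun p hp => hiso _ (hxC p hp).1))
  have hnot : ∀ p ∈ P, ¬ W ⊆ p.1 := fun p hp h =>
    (hxC p hp).2 (h (hEW (subset_closure ⟨p, hp, rfl⟩)))
  obtain ⟨p, hp, hpW⟩ := hunb W hW
  have hWp : W ⊆ p.2 := (hchain.total hW (hP p hp).2.1).resolve_right hpW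
  obtain ⟨q, hq, hqp⟩ := hunb p.2 (hP p hp).2.1
  have hpq : p ≠ q := by
    rintro rfl
    exact hqp subset_rfl
  rcases hpair hp hq hpq with h | h
  · exact hnot q hq (hWp.trans h)
  · have hp1W : p.1 ⊆ W := (hchain.total hW (hP p hp).1).resolve_left (hnot p hp)
    exact hqp ((h.trans hp1W).trans hWp)

theorem OdLle.linLle_of_isClosed [T1Space X] (hod : OdLle X κ) (hκ : ℵ₀ ≤ κ) {C : Set X}
    (hC : IsClosed C) (hiso : ∀ x ∈ C, ¬ IsOpen ({x} : Set X)) : LinLle C κ := by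
  intro S hS hchain hcov
  obtain ⟨T, hTS, hT, hCT⟩ := hod.exists_subcover_of_isChain hκ hC hiso
    (S := (fun V : Set C => (Subtype.val '' Vᶜ)ᶜ) '' S)
    (by
      rintro _ ⟨V, hV, rfl⟩
      exact (hC.isClosedMap_subtype_val _ (hS V hV).isClosed_compl).isOpen_compl)
    (by
      rintro _ ⟨U, hU, rfl⟩ _ ⟨V, hV, rfl⟩ _
      rcases hchain.total hU hV with h | h
      · exact Or.inl (compl_subset_compl.2 (image_mono (compl_subset_compl.2 h)))
      · exact Or.inr (compl_subset_compl.2 (image_mono (compl_subset_compl.2 h))))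
    (by
      intro x hx
      obtain ⟨V, hV, hxV⟩ : (⟨x, hx⟩ : C) ∈ ⋃₀ S := hcov ▸ mem_univ _
      refine ⟨_, ⟨V, hV, rfl⟩, ?_⟩
      rintro ⟨y, hy, rfl⟩
      exact hy hxV)
  obtain ⟨R, hRS, rfl, hR⟩ := exists_subset_image_eq_mk_le hTS
  refine ⟨R, hRS, hR.trans_lt hT, eq_univ_of_forall fun x => ?_⟩
  obtain ⟨_, ⟨V, hV, rfl⟩, hxV⟩ := hCT x.2
  refine ⟨V, hV, ?_⟩
  by_contra h
  exact hxV ⟨x, h, rfl⟩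

end


theorem stmt_15 (X : Type u) [TopologicalSpace X] [T1Space X]
    (κ : Cardinal.{u}) (hκreg : κ.IsRegular) (hκ : Cardinal.aleph 1 ≤ κ)
    (hod : OdLle X κ)
    (D : Set X) (hD : D = {x : X | IsOpen ({x} : Set X)}) :
    ∃ X₀ X₁ : Set X,
      Disjoint D X₀ ∧ Disjoint D X₁ ∧ Disjoint X₀ X₁ ∧
      D ∪ X₀ ∪ X₁ = Set.univ ∧
      IsOpen (X₀ ∪ D) ∧
      Lle (closure X₀) κ ∧
      IsClosed X₁ ∧
      LinLle X₁ κ ∧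
      ∀ U : Set X, IsOpen U → (U ∩ X₁).Nonempty → ¬ Lle U κ := by

  have hκ₀ : ℵ₀ ≤ κ := hκreg.aleph0_le
  have hDopen : IsOpen D := by
    rw [← biUnion_of_singleton D]
    refine isOpen_biUnion fun x hx => ?_
    rw [hD] at hx
    exact hx
  set W : Set X := ⋃₀ {U | IsOpen U ∧ IsSmall κ U}
  have hWopen : IsOpen W := isOpen_sUnion fun U hU => hU.1
  have hDW : D ⊆ W := fun x hx => by
    rw [hD] at hx
    exact ⟨{x}, ⟨hx, isSmall_singleton hκ₀ x⟩, rfl⟩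
  have hisoD : ∀ x, x ∉ D → ¬ IsOpen ({x} : Set X) := fun x hx h => by
    rw [hD] at hx
    exact hx h
  refine ⟨W \ D, Wᶜ, disjoint_sdiff_right, disjoint_compl_right.mono_left hDW,
    disjoint_compl_right.mono_left sdiff_subset, ?_, ?_, ?_, hWopen.isClosed_compl, ?_, ?_⟩
  · rw [union_sdiff_cancel hDW, union_compl_self]
  · rwa [sdiff_union_of_subset hDW]
  · rw [← isSmall_iff_Lle]
    have hfrontier : IsSmall κ (closure D \ D) := by
      refine hod.isSmall_of_interior_eq_empty hκ₀ (isClosed_closure.sdiff hDopen) ?_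
      rw [← hDopen.frontier_eq, ← frontier_compl]
      exact interior_frontier hDopen.isClosed_compl
    have hrest : IsSmall κ (closure (W \ closure D)) :=
      hod.isSmall_closure hκreg (hWopen.sdiff isClosed_closure)
        (fun x hx => hisoD x fun h => hx.2 (subset_closure h))
        (fun x hx => by
          obtain ⟨U, hU, hxU⟩ := hx.1
          exact ⟨U, hU.1, hxU, hU.2⟩)
    refine (hfrontier.union hκ₀ hrest).of_isClosed_subset isClosed_closure ?_
    refine closure_minimal (fun x hx => ?_)
      ((isClosed_closure.sdiff hDopen).union isClosed_closure)
    by_cases h : x ∈ closure D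
    · exact Or.inl ⟨h, hx.2⟩
    · exact Or.inr (subset_closure ⟨hx.1, h⟩)
  · exact hod.linLle_of_isClosed hκ₀ hWopen.isClosed_compl
      fun x hx => hisoD x fun h => hx (hDW h)
  · rintro U hU ⟨x, hxU, hxW⟩ hL
    exact hxW ⟨U, ⟨hU, isSmall_iff_Lle.2 hL⟩, hxU⟩
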